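/- Let (Ω, 𝒜, P) be a complete probability space, E a real Banach space, F : Ω → ℭ(E) strongly measurable with ∫_Ω ‖F‖ dP < ∞, and let r > 0 and σ > 0. Then for every measurable selection φ of the map ω ↦ closure(F(ω) + rB), where B is the open unit ball of E, there exist a measurable selection f of F and a measurable selection γ of the closed unit ball of E such that φ(ω) = f(ω) + (r+σ) γ(ω) for almost every ω ∈ Ω. -/

import Mathlib

open Metric Filter Topology MeasureTheory Pointwise

variable {Ω : Type*} [MeasurableSpace Ω]
variable {E : Type*} [NormedAddCommGroup E] [NormedSpace ℝ E] [CompleteSpace E]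

/-- The excess `e(A,B) = sup_{a ∈ A} d(a, B)`. -/
noncomputable def excess (A B : Set E) : ℝ := sSup ((fun a => infDist a B) '' A)

/-- The Pompeiu–Hausdorff distance `h(A,B) = max (e(A,B)) (e(B,A))`. -/
noncomputable def hdist (A B : Set E) : ℝ := max (excess A B) (excess B A)

/-- Membership in `ℭ(E)`: nonempty, closed and bounded. -/
def IsCB (A : Set E) : Prop := A.Nonempty ∧ IsClosed A ∧ Bornology.IsBounded A

/-- A map is countably-valued if it is constant on each piece of a countable measurable
partition of `Ω`. -/
def CountablyValued {α : Type*} (g : Ω → α) : Prop :=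
  ∃ (P : ℕ → Set Ω) (a : ℕ → α),
    (∀ i, MeasurableSet (P i)) ∧ Pairwise (Function.onFun Disjoint P) ∧
    (⋃ i, P i) = Set.univ ∧ ∀ i, ∀ ω ∈ P i, g ω = a i

/-- A set-valued map `F : Ω → ℭ(E)` is strongly measurable if some sequence of
countably-valued maps with values in `ℭ(E)` converges to it uniformly almost surely in
the Pompeiu–Hausdorff metric. -/
def SMeasurableSet (μ : Measure Ω) (F : Ω → Set E) : Prop :=
  ∃ G : ℕ → Ω → Set E,
    (∀ n, CountablyValued (G n)) ∧ (∀ n ω, IsCB (G n ω)) ∧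
    ∀ ε : ℝ, 0 < ε → ∃ N : ℕ, ∀ n ≥ N, ∀ᵐ ω ∂μ, hdist (G n ω) (F ω) ≤ ε

/-- A single-valued map `f : Ω → E` is measurable (in the sense of Hille–Phillips) if
some sequence of countably-valued maps converges to it uniformly almost surely. -/
def PMeasurable (μ : Measure Ω) (f : Ω → E) : Prop :=
  ∃ g : ℕ → Ω → E, (∀ n, CountablyValued (g n)) ∧
    ∀ ε : ℝ, 0 < ε → ∃ N : ℕ, ∀ n ≥ N, ∀ᵐ ω ∂μ, ‖g n ω - f ω‖ ≤ ε

theorem CountablyValued.prodMk {α β : Type*} {g : Ω → α} {k : Ω → β}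
    (hg : CountablyValued g) (hk : CountablyValued k) :
    CountablyValued fun ω => (g ω, k ω) := by
  obtain ⟨P, a, hPm, hPd, hPu, hPa⟩ := hg
  obtain ⟨Q, b, hQm, hQd, hQu, hQb⟩ := hk
  refine ⟨fun n => P n.unpair.1 ∩ Q n.unpair.2, fun n => (a n.unpair.1, b n.unpair.2),
    fun n => (hPm _).inter (hQm _), ?_, ?_, ?_⟩
  · intro m n hmn
    rw [Function.onFun, Set.disjoint_left]
    rintro ω ⟨h1, h2⟩ ⟨h3, h4⟩
    apply hmn
    have e1 : m.unpair.1 = n.unpair.1 := by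
      by_contra h
      exact Set.disjoint_left.1 (hPd h) h1 h3
    have e2 : m.unpair.2 = n.unpair.2 := by
      by_contra h
      exact Set.disjoint_left.1 (hQd h) h2 h4
    rw [← Nat.pair_unpair m, ← Nat.pair_unpair n, e1, e2]
  · refine Set.eq_univ_of_forall fun ω => ?_
    obtain ⟨i, hi⟩ := Set.mem_iUnion.1 (hPu ▸ Set.mem_univ ω)
    obtain ⟨j, hj⟩ := Set.mem_iUnion.1 (hQu ▸ Set.mem_univ ω)
    refine Set.mem_iUnion.2 ⟨Nat.pair i j, ?_⟩
    simpa using ⟨hi, hj⟩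
  · rintro n ω ⟨h1, h2⟩
    exact Prod.ext (hPa _ ω h1) (hQb _ ω h2)

theorem CountablyValued.comp {α β : Type*} {g : Ω → α} (hg : CountablyValued g) (k : α → β) :
    CountablyValued fun ω => k (g ω) := by
  obtain ⟨P, a, hPm, hPd, hPu, hPa⟩ := hg
  exact ⟨P, k ∘ a, hPm, hPd, hPu, fun i ω hω => congrArg k (hPa i ω hω)⟩

omit [NormedSpace ℝ E] [CompleteSpace E] in
theorem CountablyValued.pMeasurable {g : Ω → E} (hg : CountablyValued g) (μ : Measure Ω) :
    PMeasurable μ g :=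
  ⟨fun _ => g, fun _ => hg, fun ε hε => ⟨0, fun _ _ => by simp [hε.le]⟩⟩

omit [NormedSpace ℝ E] [CompleteSpace E] in
theorem PMeasurable.sub {μ : Measure Ω} {f g : Ω → E} (hf : PMeasurable μ f)
    (hg : PMeasurable μ g) : PMeasurable μ fun ω => f ω - g ω := by
  obtain ⟨u, hu, hu'⟩ := hf
  obtain ⟨v, hv, hv'⟩ := hg
  refine ⟨fun n ω => u n ω - v n ω, fun n => ((hu n).prodMk (hv n)).comp fun p => p.1 - p.2,
    fun ε hε => ?_⟩
  obtain ⟨M, hM⟩ := hu' (ε / 2) (by positivity)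
  obtain ⟨N, hN⟩ := hv' (ε / 2) (by positivity)
  refine ⟨max M N, fun n hn => ?_⟩
  filter_upwards [hM n (le_of_max_le_left hn), hN n (le_of_max_le_right hn)] with ω h1 h2
  calc ‖u n ω - v n ω - (f ω - g ω)‖ = ‖(u n ω - f ω) - (v n ω - g ω)‖ := by
        congr 1; abel
    _ ≤ ‖u n ω - f ω‖ + ‖v n ω - g ω‖ := norm_sub_le _ _
    _ ≤ ε := by linarith

omit [CompleteSpace E] in
theorem PMeasurable.const_smul {μ : Measure Ω} {f : Ω → E} (hf : PMeasurable μ f) (c : ℝ) :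
    PMeasurable μ fun ω => c • f ω := by
  obtain ⟨u, hu, hu'⟩ := hf
  refine ⟨fun n ω => c • u n ω, fun n => (hu n).comp fun x => c • x, fun ε hε => ?_⟩
  obtain ⟨N, hN⟩ := hu' (ε / (|c| + 1)) (by positivity)
  refine ⟨N, fun n hn => ?_⟩
  filter_upwards [hN n hn] with ω h
  rw [← smul_sub, norm_smul, Real.norm_eq_abs]
  calc |c| * ‖u n ω - f ω‖ ≤ (|c| + 1) * (ε / (|c| + 1)) := by gcongr; linarith
    _ = ε := by field_simp

omit [NormedSpace ℝ E] [CompleteSpace E] in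
theorem infDist_le_excess {A B : Set E} (hA : IsCB A) (hB : IsCB B) {a : E} (ha : a ∈ A) :
    infDist a B ≤ excess A B := by
  refine le_csSup ?_ (Set.mem_image_of_mem _ ha)
  obtain ⟨b, hb⟩ := hB.1
  obtain ⟨R, hR⟩ := hA.2.2.subset_closedBall b
  refine ⟨R, ?_⟩
  rintro _ ⟨x, hx, rfl⟩
  exact (infDist_le_dist_of_mem hb).trans (hR hx)

omit [NormedSpace ℝ E] [CompleteSpace E] in
theorem infDist_le_infDist_add_excess {A B : Set E} (hA : IsCB A) (hB : IsCB B) (x : E) :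
    infDist x B ≤ infDist x A + excess A B := by
  refine le_of_forall_pos_lt_add fun ε hε => ?_
  obtain ⟨a, ha, hxa⟩ := (infDist_lt_iff hA.1).1 (lt_add_of_pos_right (infDist x A) hε)
  have h1 := infDist_le_infDist_add_dist (s := B) (x := x) (y := a)
  have h2 := infDist_le_excess hA hB ha
  linarith

omit [CompleteSpace E] in
theorem infDist_le_of_mem_closure_add_smul_ball {A : Set E} {r : ℝ} (hr : 0 < r) {x : E}
    (hx : x ∈ closure (A + r • ball (0 : E) 1)) : infDist x A ≤ r := by
  refine closure_minimal (t := {y | infDist y A ≤ r}) ?_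
    (isClosed_le (continuous_infDist_pt A) continuous_const) hx
  rintro _ ⟨a, ha, _, ⟨b, hb, rfl⟩, rfl⟩
  refine (infDist_le_dist_of_mem ha).trans ?_
  have hb' : ‖b‖ ≤ 1 := (mem_ball_zero_iff.1 hb).le
  simpa [dist_eq_norm, norm_smul, abs_of_pos hr] using mul_le_mul_of_nonneg_left hb' hr.le

omit [NormedSpace ℝ E] [CompleteSpace E] in
/-- A measurable map at distance at most `ρ` from `F` can be moved by little more than `ρ` to a
countably-valued map which is arbitrarily close to `F`. -/
theorem exists_countablyValued_infDist_le {μ : Measure Ω} {F : Ω → Set E}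
    (hF : ∀ ω, IsCB (F ω)) (hFm : SMeasurableSet μ F) {f : Ω → E} (hf : PMeasurable μ f) {ρ : ℝ}
    (hρ : ∀ᵐ ω ∂μ, infDist (f ω) (F ω) ≤ ρ) {η : ℝ} (hη : 0 < η) :
    ∃ f' : Ω → E, CountablyValued f' ∧ (∀ᵐ ω ∂μ, infDist (f' ω) (F ω) ≤ η) ∧
      ∀ᵐ ω ∂μ, dist (f ω) (f' ω) ≤ ρ + η := by
  classical
  obtain ⟨G, hG, hGcb, hGF⟩ := hFm
  obtain ⟨g, hg, hgf⟩ := hf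
  obtain ⟨M, hM⟩ := hGF (η / 5) (by positivity)
  obtain ⟨N, hN⟩ := hgf (η / 5) (by positivity)
  let sel : E × Set E → E := fun p =>
    if h : ∃ b ∈ p.2, dist p.1 b < ρ + 3 * η / 4 then h.choose else 0
  refine ⟨fun ω => sel (g N ω, G M ω), ((hg N).prodMk (hG M)).comp sel, ?_⟩
  have key : ∀ᵐ ω ∂μ, infDist (sel (g N ω, G M ω)) (F ω) ≤ η ∧
      dist (f ω) (sel (g N ω, G M ω)) ≤ ρ + η := by
    filter_upwards [hρ, hM M le_rfl, hN N le_rfl] with ω hfF hGFω hgfω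
    rw [← dist_eq_norm] at hgfω
    have hGe : excess (G M ω) (F ω) ≤ η / 5 := (le_max_left _ _).trans hGFω
    have hFe : excess (F ω) (G M ω) ≤ η / 5 := (le_max_right _ _).trans hGFω
    have h1 := infDist_le_infDist_add_excess (hF ω) (hGcb M ω) (g N ω)
    have h2 := infDist_le_infDist_add_dist (s := F ω) (x := g N ω) (y := f ω)
    have hex : ∃ b ∈ G M ω, dist (g N ω) b < ρ + 3 * η / 4 :=
      (infDist_lt_iff (hGcb M ω).1).1 (by linarith)
    have hsel : sel (g N ω, G M ω) = hex.choose := dif_pos hex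
    rw [hsel]
    have h3 := infDist_le_excess (hGcb M ω) (hF ω) hex.choose_spec.1
    have h4 := hex.choose_spec.2
    have h5 := dist_triangle_left (f ω) hex.choose (g N ω)
    exact ⟨by linarith, by linarith⟩
  exact ⟨key.mono fun _ h => h.1, key.mono fun _ h => h.2⟩

/-- Proposition 5.2: every measurable selection `φ` of `ω ↦ closure (F(ω) + rB)` (where
`B` is the open unit ball) decomposes, for any `σ > 0`, as `φ = f + (r+σ)γ` a.e., with
`f` a measurable selection of `F` and `γ` a measurable selection of the closed unit
ball. -/
theorem selection_decomposition (μ : Measure Ω) [IsProbabilityMeasure μ] [μ.IsComplete]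
    (F : Ω → Set E) (hF : ∀ ω, IsCB (F ω)) (hFm : SMeasurableSet μ F)
    (hFi : ∫⁻ ω, ENNReal.ofReal (sSup ((fun x => ‖x‖) '' F ω)) ∂μ < ⊤)
    (r σ : ℝ) (hr : 0 < r) (hσ : 0 < σ)
    (φ : Ω → E) (hφm : PMeasurable μ φ)
    (hφ : ∀ᵐ ω ∂μ, φ ω ∈ closure (F ω + r • ball (0 : E) 1)) :
    ∃ f γ : Ω → E,
      PMeasurable μ f ∧ (∀ᵐ ω ∂μ, f ω ∈ F ω) ∧
      PMeasurable μ γ ∧ (∀ᵐ ω ∂μ, γ ω ∈ closedBall (0 : E) 1) ∧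
      ∀ᵐ ω ∂μ, φ ω = f ω + (r + σ) • γ ω := by
  obtain ⟨c, hc, hcσ⟩ : ∃ c : ℝ, 0 < c ∧ 5 * c = σ := ⟨σ / 5, by positivity, by ring⟩
  have hη : ∀ n : ℕ, 0 < c / 2 ^ n := fun n => by positivity
  obtain ⟨u₀, hu₀, hu₀F, hu₀φ⟩ := exists_countablyValued_infDist_le hF hFm hφm
    (hφ.mono fun ω h => infDist_le_of_mem_closure_add_smul_ball hr h) (hη 0)
  let S (n : ℕ) : Type _ :=
    {u : Ω → E // CountablyValued u ∧ ∀ᵐ ω ∂μ, infDist (u ω) (F ω) ≤ c / 2 ^ n}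
  have step : ∀ n (u : S n), ∃ v : S (n + 1),
      ∀ᵐ ω ∂μ, dist (u.1 ω) (v.1 ω) ≤ c / 2 ^ n + c / 2 ^ (n + 1) := fun n u => by
    obtain ⟨v, hv, hvF, hvu⟩ := exists_countablyValued_infDist_le hF hFm
      (u.2.1.pMeasurable μ) u.2.2 (hη (n + 1))
    exact ⟨⟨v, hv, hvF⟩, hvu⟩
  choose next hnext using step
  let U (n : ℕ) : S n := Nat.rec ⟨u₀, hu₀, hu₀F⟩ next n
  have hUF : ∀ᵐ ω ∂μ, ∀ n, infDist ((U n).1 ω) (F ω) ≤ c / 2 ^ n :=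
    ae_all_iff.2 fun n => (U n).2.2
  have hUU : ∀ᵐ ω ∂μ, ∀ n, dist ((U n).1 ω) ((U (n + 1)).1 ω) ≤ 4 * c / 2 / 2 ^ n := by
    refine ae_all_iff.2 fun n => (hnext n (U n)).mono fun ω h => h.trans ?_
    have := hη n
    have e1 : c / 2 ^ (n + 1) = c / 2 ^ n / 2 := by rw [pow_succ]; field_simp
    have e2 : 4 * c / 2 / 2 ^ n = 2 * (c / 2 ^ n) := by ring
    linarith
  have hlim : ∀ᵐ ω ∂μ, ∃ x, Tendsto (fun n => (U n).1 ω) atTop (𝓝 x) :=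
    hUU.mono fun ω h => cauchySeq_tendsto_of_complete (cauchySeq_of_le_geometric_two h)
  let f : Ω → E := fun ω => limUnder atTop fun n => (U n).1 ω
  have hf : ∀ᵐ ω ∂μ, Tendsto (fun n => (U n).1 ω) atTop (𝓝 (f ω)) :=
    hlim.mono fun ω h => tendsto_nhds_limUnder h
  have hUf : ∀ᵐ ω ∂μ, ∀ n, dist ((U n).1 ω) (f ω) ≤ 4 * c / 2 ^ n := by
    filter_upwards [hUU, hf] with ω h1 h2 n
    exact dist_le_of_le_geometric_two_of_tendsto h1 h2 n
  have hto : ∀ b : ℝ, Tendsto (fun n : ℕ => b / 2 ^ n) atTop (𝓝 0) := fun b =>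
    tendsto_const_nhds.div_atTop (tendsto_pow_atTop_atTop_of_one_lt one_lt_two)
  have hfm : PMeasurable μ f := by
    refine ⟨fun n => (U n).1, fun n => (U n).2.1, fun ε hε => ?_⟩
    obtain ⟨N, hN⟩ := eventually_atTop.1 ((hto (4 * c)).eventually_le_const hε)
    refine ⟨N, fun n hn => hUf.mono fun ω h => ?_⟩
    rw [← dist_eq_norm]
    exact (h n).trans (hN n hn)
  have hfF : ∀ᵐ ω ∂μ, f ω ∈ F ω := by
    filter_upwards [hUF, hf] with ω h1 h2
    rw [(hF ω).2.1.mem_iff_infDist_zero (hF ω).1]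
    exact le_antisymm
      (le_of_tendsto_of_tendsto' (((continuous_infDist_pt _).tendsto _).comp h2) (hto c) h1)
      infDist_nonneg
  have hrσ : 0 < r + σ := add_pos hr hσ
  refine ⟨f, fun ω => (r + σ)⁻¹ • (φ ω - f ω), hfm, hfF, (hφm.sub hfm).const_smul _, ?_, ?_⟩
  · filter_upwards [hu₀φ, hUf] with ω h1 h2
    have h3 : dist (u₀ ω) (f ω) ≤ 4 * c / 2 ^ 0 := h2 0
    have h4 := dist_triangle (φ ω) (u₀ ω) (f ω)
    rw [pow_zero, div_one] at h1 h3
    rw [mem_closedBall_zero_iff, norm_smul, norm_inv, Real.norm_of_nonneg hrσ.le, ← dist_eq_norm,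
      inv_mul_le_iff₀ hrσ]
    linarith
  · refine Eventually.of_forall fun ω => ?_
    rw [smul_inv_smul₀ hrσ.ne', add_sub_cancel]
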